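/- For every C₀ > 1 and every δ > 0 there exist ρ > 0 and ε₀ > 0 such that for all ε ∈ (0, ε₀) and all x ∈ Ω_ε with C₀·ε ≤ |x − x₀| ≤ ρ, one has |∇u_ε(x) − ∇u₀(x) − u₀(x₀)·(x − x₀)/(|log ε|·|x − x₀|²)| ≤ δ/(|log ε|·|x − x₀|). -/

import Mathlib

open Real Set Metric Filter Topology

noncomputable section

abbrev E2 := EuclideanSpace ℝ (Fin 2)

/-- Second partial derivative `∂²u/∂xᵢ∂xⱼ` at `x`. -/
noncomputable def pd2 (u : E2 → ℝ) (x : E2) (i j : Fin 2) : ℝ :=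
  fderiv ℝ (fun y => fderiv ℝ u y (EuclideanSpace.single j 1)) x (EuclideanSpace.single i 1)

/-- The Hessian matrix `D²u(x)`. -/
noncomputable def Hess (u : E2 → ℝ) (x : E2) : Matrix (Fin 2) (Fin 2) ℝ :=
  Matrix.of fun i j => pd2 u x i j

/-- The Laplacian `Δu(x)`. -/
noncomputable def lap (u : E2 → ℝ) (x : E2) : ℝ := pd2 u x 0 0 + pd2 u x 1 1

/-- The largest eigenvalue of a symmetric 2×2 real matrix. -/
noncomputable def lambdaMax (M : Matrix (Fin 2) (Fin 2) ℝ) : ℝ :=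
  ((M 0 0 + M 1 1) + Real.sqrt ((M 0 0 - M 1 1) ^ 2 + (M 0 1 + M 1 0) ^ 2)) / 2

/-- `u` is the torsion function of `U`: continuous up to the boundary, `C²` inside,
`Δu = -1` in `U` and `u = 0` on `∂U`. -/
def IsTorsion (U : Set E2) (u : E2 → ℝ) : Prop :=
  ContinuousOn u (closure U) ∧ (∀ x ∈ U, ContDiffAt ℝ 2 u x) ∧
    (∀ x ∈ U, lap u x = -1) ∧ (∀ x ∈ frontier U, u x = 0)


/-- The complex gradient `∂ₓf - i ∂ᵧf` of a real function on the plane; it is holomorphic where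
`f` is harmonic. -/
def complexGrad (f : ℂ → ℝ) (z : ℂ) : ℂ := fderiv ℝ f z 1 - Complex.I * fderiv ℝ f z Complex.I

lemma norm_fderiv_le_norm_complexGrad (f : ℂ → ℝ) (z : ℂ) :
    ‖fderiv ℝ f z‖ ≤ ‖complexGrad f z‖ := by
  refine ContinuousLinearMap.opNorm_le_bound _ (norm_nonneg _) fun v => ?_
  have hv : fderiv ℝ f z v = (complexGrad f z * v).re := by
    have h : v = v.re • (1 : ℂ) + v.im • Complex.I := by
      apply Complex.ext <;> simp
    conv_lhs => rw [h]
    rw [map_add, map_smul, map_smul]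
    simp [complexGrad]
    ring
  rw [hv, ← norm_mul]
  exact Complex.abs_re_le_norm _

/-- Maximum principle for harmonic functions on bounded open subsets of the plane. -/
lemma harmonic_le_of_frontier_le {U : Set ℂ} (hU : IsOpen U) (hb : Bornology.IsBounded U)
    {f : ℂ → ℝ} (hf : InnerProductSpace.HarmonicOnNhd f U) (hc : ContinuousOn f (closure U)) {M : ℝ}
    (hM : ∀ z ∈ frontier U, f z ≤ M) : ∀ z ∈ U, f z ≤ M := by
  intro z hz
  have hK : IsCompact (closure U) := hb.isCompact_closure
  obtain ⟨p, hp, hmax⟩ := hK.exists_isMaxOn ⟨z, subset_closure hz⟩ hc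
  have hK' : IsCompact (closure U ∩ f ⁻¹' {f p}) :=
    hK.of_isClosed_subset (hc.preimage_isClosed_of_isClosed isClosed_closure isClosed_singleton)
      inter_subset_left
  obtain ⟨q, ⟨hq, hqp⟩, hqmax⟩ :=
    hK'.exists_isMaxOn ⟨p, hp, rfl⟩ Complex.continuous_re.continuousOn
  have hqp' : f q = f p := hqp
  refine (hmax (subset_closure hz) : f z ≤ f p).trans ?_
  rw [← hqp']
  by_cases hqU : q ∈ U
  swap
  · exact hM q (by rw [frontier, hU.interior_eq]; exact ⟨hq, hqU⟩)
  exfalso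
  obtain ⟨r, hr, hrU⟩ := Metric.isOpen_iff.1 hU q hqU
  obtain ⟨F, hF, hFf⟩ := (hf.mono hrU).exists_analyticOnNhd_ball_re_eq
  have hd : ∀ᶠ w in 𝓝 q, DifferentiableAt ℂ (fun w => Complex.exp (F w)) w := by
    filter_upwards [ball_mem_nhds q hr] with w hw
    exact (hF w hw).differentiableAt.cexp
  have hlm : IsLocalMax (norm ∘ fun w => Complex.exp (F w)) q := by
    filter_upwards [ball_mem_nhds q hr] with w hw
    have h1 : (F w).re = f w := hFf hw
    have h2 : (F q).re = f q := hFf (mem_ball_self hr)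
    simp only [Function.comp, Complex.norm_exp, h1, h2, hqp']
    exact Real.exp_le_exp.2 (hmax (subset_closure (hrU hw)))
  have hev := (Complex.eventually_eq_of_isLocalMax_norm hd hlm).and (ball_mem_nhds q hr)
  obtain ⟨s, hs, hsb⟩ := Metric.eventually_nhds_iff.1 hev
  have hq' := @hsb (q + (s / 2 : ℝ)) (by
    rw [dist_eq_norm, add_sub_cancel_left, Complex.norm_real, Real.norm_eq_abs, abs_of_pos] <;>
      linarith)
  have h1 : (F (q + (s / 2 : ℝ))).re = f (q + (s / 2 : ℝ)) := hFf hq'.2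
  have h2 : (F q).re = f q := hFf (mem_ball_self hr)
  have h3 := congrArg norm hq'.1
  rw [Complex.norm_exp, Complex.norm_exp, Real.exp_eq_exp, h1, h2] at h3
  have h4 := hqmax (a := q + (s / 2 : ℝ)) ⟨subset_closure (hrU hq'.2), h3.trans hqp'⟩
  have h5 : q.re + s / 2 ≤ q.re := by simpa using h4
  linarith

lemma abs_le_of_frontier_abs_le {U : Set ℂ} (hU : IsOpen U) (hb : Bornology.IsBounded U)
    {f : ℂ → ℝ} (hf : InnerProductSpace.HarmonicOnNhd f U) (hc : ContinuousOn f (closure U)) {M : ℝ}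
    (hM : ∀ z ∈ frontier U, |f z| ≤ M) : ∀ z ∈ U, |f z| ≤ M := fun z hz =>
  abs_le'.2 ⟨harmonic_le_of_frontier_le hU hb hf hc (fun w hw => (le_abs_self _).trans (hM w hw)) z hz,
    harmonic_le_of_frontier_le hU hb hf.neg hc.neg
      (fun w hw => (neg_le_abs _).trans (hM w hw)) z hz⟩

/-- Interior gradient estimate for harmonic functions. -/
lemma norm_complexGrad_le {f : ℂ → ℝ} {c : ℂ} {r M : ℝ} (hr : 0 < r) (hM : 0 < M)
    (hf : InnerProductSpace.HarmonicOnNhd f (ball c r)) (hb : ∀ z ∈ ball c r, |f z| ≤ M) :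
    ‖complexGrad f c‖ ≤ 8 * M / r := by
  obtain ⟨F, hF, hFf⟩ := hf.exists_analyticOnNhd_ball_re_eq
  have hcm : c ∈ ball c r := mem_ball_self hr
  have hder : complexGrad f c = deriv F c := by
    have h1 : HasFDerivAt f (Complex.reCLM.comp
        ((ContinuousLinearMap.toSpanSingleton ℂ (deriv F c)).restrictScalars ℝ)) c := by
      refine HasFDerivAt.congr_of_eventuallyEq (f := fun z => (F z).re) ?_ ?_
      · exact Complex.reCLM.hasFDerivAt.comp c
          ((hF c hcm).differentiableAt.hasDerivAt.hasFDerivAt.restrictScalars ℝ)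
      · filter_upwards [ball_mem_nhds c hr] with w hw using (hFf hw).symm
    rw [complexGrad, h1.fderiv]
    apply Complex.ext <;> simp
  rw [hder]
  set G : ℂ → ℂ := fun z => F (c + z) - F c with hG
  have hmem : ∀ z ∈ ball (0 : ℂ) r, c + z ∈ ball c r := fun z hz => by simpa using hz
  have hGd : DifferentiableOn ℂ G (ball 0 r) := fun z hz => by
    have := (hF _ (hmem z hz)).differentiableAt
    exact ((this.comp z ((differentiableAt_id).const_add c)).sub_const _).differentiableWithinAt
  have hGb : ∀ z ∈ sphere (0 : ℂ) (r / 2), ‖G z‖ ≤ 4 * M := by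
    intro z hz
    have hz' : ‖z‖ = r / 2 := by simpa using hz
    have hzb : z ∈ ball (0 : ℂ) r := by simp [hz']; linarith
    refine (Complex.borelCaratheodory_zero (M := 2 * M) (R := r) (by linarith) hGd ?_ hr hzb
      (by simp [hG])).trans (le_of_eq ?_)
    · intro w hw
      have h1 : (F (c + w)).re = f (c + w) := hFf (hmem w hw)
      have h2 : (F c).re = f c := hFf hcm
      have h3 := abs_le.1 (hb _ (hmem w hw))
      have h4 := abs_le.1 (hb _ hcm)
      simp only [hG, mem_ofPred_eq, Complex.sub_re, h1, h2]
      linarith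
    · rw [hz']; field_simp; ring
  have h := Complex.norm_deriv_le_of_forall_mem_sphere_norm_le (f := G) (half_pos hr)
    (DifferentiableOn.diffContOnCl (hGd.mono (fun z hz => by
      have := closure_ball_subset_closedBall hz
      simp at this ⊢; linarith))) hGb
  have hd : deriv G 0 = deriv F c := by
    simp only [hG, deriv_sub_const_fun]
    rw [deriv_comp_const_add, add_zero]
  rw [hd] at h
  refine h.trans (le_of_eq ?_)
  field_simp; ring

/-- Cauchy estimate on an annulus: the value of a holomorphic function is controlled by
its size on the two boundary circles. -/
lemma norm_le_of_annulus {g : ℂ → ℂ} {s R A B : ℝ} (hs : 0 < s)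
    (hg : ∀ z, s ≤ ‖z‖ → ‖z‖ ≤ R → DifferentiableAt ℂ g z)
    (hA : ∀ z, ‖z‖ = R → ‖g z‖ ≤ A) (hB : ∀ z, ‖z‖ = s → ‖g z‖ ≤ B)
    {z : ℂ} (hsz : s < ‖z‖) (hzR : ‖z‖ < R) :
    ‖g z‖ ≤ R * (A / (R - ‖z‖)) + s * (B / (‖z‖ - s)) := by
  have hR : 0 < R := by linarith
  have hz := hg z hsz.le hzR.le
  have hgc : ∀ ρ : ℝ, 0 ≤ ρ → s ≤ ρ → ρ ≤ R → ContinuousOn g (sphere 0 ρ) := fun ρ _ h1 h2 w hw => by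
    have hw' : ‖w‖ = ρ := by simpa using hw
    exact (hg w (by linarith) (by linarith)).continuousAt.continuousWithinAt
  have key : (∮ w in C(0, R), dslope g z w) = ∮ w in C(0, s), dslope g z w := by
    refine Complex.circleIntegral_eq_of_differentiable_on_annulus_off_countable hs (by linarith)
      (countable_singleton z) ?_ ?_
    · intro w hw
      have h1 : s ≤ ‖w‖ ∧ ‖w‖ ≤ R := by simpa [and_comm] using hw
      by_cases h : w = z
      · subst h; exact (continuousAt_dslope_same.2 hz).continuousWithinAt
      · exact ((continuousAt_dslope_of_ne h).2
          (hg w h1.1 h1.2).continuousAt).continuousWithinAt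
    · rintro w ⟨hw, hwz⟩
      have h1 : s < ‖w‖ ∧ ‖w‖ < R := by simpa [and_comm] using hw
      exact (differentiableAt_dslope_of_ne hwz).2 (hg w h1.1.le h1.2.le)
  have hne : ∀ ρ : ℝ, ρ ≠ ‖z‖ → ∀ w ∈ sphere (0 : ℂ) ρ, w ≠ z := by
    rintro ρ h w hw rfl
    exact h (by simpa using hw.symm)
  have hinv : ∀ ρ : ℝ, ρ ≠ ‖z‖ → ContinuousOn (fun w : ℂ => (w - z)⁻¹) (sphere 0 ρ) := fun ρ h =>
    (continuousOn_id.sub continuousOn_const).inv₀ fun w hw => sub_ne_zero.2 (hne ρ h w hw)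
  have split : ∀ ρ : ℝ, s ≤ ρ → ρ ≤ R → ρ ≠ ‖z‖ → (∮ w in C(0, ρ), dslope g z w) =
      (∮ w in C(0, ρ), (w - z)⁻¹ • g w) - (∮ w in C(0, ρ), (w - z)⁻¹) • g z := by
    intro ρ h1 h2 h3
    have h0 : 0 ≤ ρ := by linarith
    rw [← circleIntegral.integral_smul_const, ← circleIntegral.integral_sub]
    · refine circleIntegral.integral_congr h0 fun w hw => ?_
      rw [dslope_of_ne _ (hne ρ h3 w hw), slope_def_module]
      simp [mul_sub]
    · exact ((hinv ρ h3).smul (hgc ρ h0 h1 h2)).circleIntegrable h0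
    · exact ((hinv ρ h3).smul continuousOn_const).circleIntegrable h0
  have hne' : ∀ w : ℂ, ‖w‖ ≤ s → w ≠ z := by
    rintro w h rfl
    linarith
  have hzero : (∮ w in C(0, s), (w - z)⁻¹) = 0 := by
    refine Complex.circleIntegral_eq_zero_of_differentiable_on_off_countable hs.le countable_empty
      ?_ ?_
    · exact (continuousOn_id.sub continuousOn_const).inv₀ fun w hw =>
        sub_ne_zero.2 (hne' w (by simpa using hw))
    · intro w hw
      have hw' : ‖w‖ < s := by simpa using hw
      exact (differentiableAt_id.sub_const z).inv (sub_ne_zero.2 (hne' w hw'.le))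
  rw [split R (by linarith) le_rfl hzR.ne', split s le_rfl (by linarith) hsz.ne, hzero,
    circleIntegral.integral_sub_inv_of_mem_ball (by simpa using hzR), zero_smul, sub_zero] at key
  have hI1 : ‖∮ w in C(0, R), (w - z)⁻¹ • g w‖ ≤ 2 * π * R * (A / (R - ‖z‖)) := by
    refine circleIntegral.norm_integral_le_of_norm_le_const hR.le fun w hw => ?_
    have hw' : ‖w‖ = R := by simpa using hw
    have h1 : R - ‖z‖ ≤ ‖w - z‖ := by rw [← hw']; exact norm_sub_norm_le w z
    rw [norm_smul, norm_inv, inv_mul_eq_div]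
    exact div_le_div₀ ((norm_nonneg _).trans (hA w hw')) (hA w hw') (by linarith) h1
  have hI2 : ‖∮ w in C(0, s), (w - z)⁻¹ • g w‖ ≤ 2 * π * s * (B / (‖z‖ - s)) := by
    refine circleIntegral.norm_integral_le_of_norm_le_const hs.le fun w hw => ?_
    have hw' : ‖w‖ = s := by simpa using hw
    have h1 : ‖z‖ - s ≤ ‖w - z‖ := by rw [← hw', norm_sub_rev]; exact norm_sub_norm_le z w
    rw [norm_smul, norm_inv, inv_mul_eq_div]
    exact div_le_div₀ ((norm_nonneg _).trans (hB w hw')) (hB w hw') (by linarith) h1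
  have hE : (2 * π * Complex.I : ℂ) • g z = (∮ w in C(0, R), (w - z)⁻¹ • g w) -
      ∮ w in C(0, s), (w - z)⁻¹ • g w := by rw [← key]; ring
  have hN := norm_sub_le (∮ w in C(0, R), (w - z)⁻¹ • g w) (∮ w in C(0, s), (w - z)⁻¹ • g w)
  rw [← hE, norm_smul] at hN
  have h2pi : ‖(2 * π * Complex.I : ℂ)‖ = 2 * π := by simp [abs_of_pos Real.pi_pos]
  rw [h2pi] at hN
  have hpi : (0 : ℝ) < 2 * π := by positivity
  refine le_of_mul_le_mul_left ?_ hpi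
  linarith

lemma isOpen_annulus (r R : ℝ) : IsOpen {z : ℂ | r < ‖z‖ ∧ ‖z‖ < R} :=
  (isOpen_lt continuous_const continuous_norm).inter (isOpen_lt continuous_norm continuous_const)

lemma closure_annulus_subset (r R : ℝ) :
    closure {z : ℂ | r < ‖z‖ ∧ ‖z‖ < R} ⊆ {z : ℂ | r ≤ ‖z‖ ∧ ‖z‖ ≤ R} :=
  closure_minimal (fun _ hz => ⟨hz.1.le, hz.2.le⟩)
    ((isClosed_le continuous_const continuous_norm).inter
      (isClosed_le continuous_norm continuous_const))

lemma norm_eq_of_mem_frontier_annulus {r R : ℝ} {z : ℂ}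
    (hz : z ∈ frontier {z : ℂ | r < ‖z‖ ∧ ‖z‖ < R}) : ‖z‖ = r ∨ ‖z‖ = R := by
  rw [frontier, (isOpen_annulus r R).interior_eq] at hz
  have h1 := closure_annulus_subset r R hz.1
  by_contra! h
  exact hz.2 ⟨lt_of_le_of_ne h1.1 h.1.symm, lt_of_le_of_ne h1.2 h.2⟩

lemma harmonicAt_log_norm {z : ℂ} (hz : z ≠ 0) :
    InnerProductSpace.HarmonicAt (fun w : ℂ => Real.log ‖w‖) z :=
  AnalyticAt.harmonicAt_log_norm (f := fun w => w) analyticAt_id hz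

lemma harmonic_le_log_barrier {f : ℂ → ℝ} {ε R κ N : ℝ} (hε : 0 < ε) (hεR : ε < R) (hκ : 0 ≤ κ)
    (hf : InnerProductSpace.HarmonicOnNhd f {z : ℂ | ε < ‖z‖ ∧ ‖z‖ < R})
    (hc : ContinuousOn f {z : ℂ | ε ≤ ‖z‖ ∧ ‖z‖ ≤ R})
    (h1 : ∀ z, ‖z‖ = ε → f z ≤ κ) (h2 : ∀ z, ‖z‖ = R → f z ≤ N) :
    ∀ z, ε < ‖z‖ → ‖z‖ < R → f z ≤ κ + N / Real.log (R / ε) * Real.log (‖z‖ / ε) := by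
  intro z hz1 hz2
  set k := N / Real.log (R / ε) with hk
  have hlog : 0 < Real.log (R / ε) := Real.log_pos (by rwa [one_lt_div hε])
  have key := harmonic_le_of_frontier_le (isOpen_annulus ε R) (M := κ + k * -Real.log ε)
    (f := f - k • fun w => Real.log ‖w‖)
    ((Metric.isBounded_closedBall (x := (0 : ℂ)) (r := R)).subset
      (fun w hw => by simpa using hw.2.le))
    (hf.sub (InnerProductSpace.HarmonicOnNhd.const_smul fun w hw =>
      harmonicAt_log_norm (norm_pos_iff.1 (hε.trans hw.1)))) ?_ ?_ z ⟨hz1, hz2⟩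
  · rw [Real.log_div (by linarith) hε.ne']
    simp at key
    linarith
  · refine (hc.mono (closure_annulus_subset ε R)).sub (ContinuousOn.const_smul ?_ k)
    exact continuous_norm.continuousOn.log fun w hw =>
      (hε.trans_le (closure_annulus_subset ε R hw).1).ne'
  · intro w hw
    rcases norm_eq_of_mem_frontier_annulus hw with h | h
    · simp [h]; linarith [h1 w h]
    · have := h2 w h
      have h3 : k * (Real.log R - Real.log ε) = N := by
        rw [← Real.log_div (by linarith) hε.ne', hk]
        exact div_mul_cancel₀ _ hlog.ne'
      simp [h]; linarith

lemma abs_le_log_barrier {f : ℂ → ℝ} {ε R κ N : ℝ} (hε : 0 < ε) (hεR : ε < R) (hκ : 0 ≤ κ)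
    (hf : InnerProductSpace.HarmonicOnNhd f {z : ℂ | ε < ‖z‖ ∧ ‖z‖ < R})
    (hc : ContinuousOn f {z : ℂ | ε ≤ ‖z‖ ∧ ‖z‖ ≤ R})
    (h1 : ∀ z, ‖z‖ = ε → |f z| ≤ κ) (h2 : ∀ z, ‖z‖ = R → |f z| ≤ N) :
    ∀ z, ε < ‖z‖ → ‖z‖ < R → |f z| ≤ κ + N / Real.log (R / ε) * Real.log (‖z‖ / ε) :=
  fun z hz1 hz2 => abs_le'.2 ⟨harmonic_le_log_barrier hε hεR hκ hf hc
      (fun w hw => (le_abs_self _).trans (h1 w hw))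
      (fun w hw => (le_abs_self _).trans (h2 w hw)) z hz1 hz2,
    harmonic_le_log_barrier hε hεR hκ hf.neg hc.neg
      (fun w hw => (neg_le_abs _).trans (h1 w hw))
      (fun w hw => (neg_le_abs _).trans (h2 w hw)) z hz1 hz2⟩

/-- Gradient bound for a harmonic function on an annulus `ε < |z| < R` that is bounded by `N` and
by a small constant `κ` on the inner circle. -/
lemma norm_complexGrad_mul_norm_le {f : ℂ → ℝ} {ε R κ N C₀ : ℝ} (hC : 1 < C₀) (hε : 0 < ε)
    (hεR : 4 * ε ≤ R) (hκ : 0 < κ) (hN : 0 < N)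
    (hf : InnerProductSpace.HarmonicOnNhd f {z : ℂ | ε < ‖z‖ ∧ ‖z‖ < R})
    (hc : ContinuousOn f {z : ℂ | ε ≤ ‖z‖ ∧ ‖z‖ ≤ R})
    (h1 : ∀ z, ‖z‖ = ε → |f z| ≤ κ) (h2 : ∀ z, ε < ‖z‖ → ‖z‖ ≤ R → |f z| ≤ N)
    {z : ℂ} (hz1 : C₀ * ε ≤ ‖z‖) (hz2 : ‖z‖ ≤ R / 4) :
    ‖complexGrad f z‖ * ‖z‖ ≤ 64 * N / R * ‖z‖ +
      16 * C₀ * (C₀ + 1) / (C₀ - 1) ^ 2 * (κ + N * Real.log C₀ / Real.log (R / ε)) := by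
  have hR : 0 < R := by linarith
  have hC0 : 0 < C₀ := by linarith
  have hlog : 0 < Real.log (R / ε) := Real.log_pos (by rw [one_lt_div hε]; linarith)
  have hlogC : 0 < Real.log C₀ := Real.log_pos hC
  set P := κ + N * Real.log C₀ / Real.log (R / ε) with hP
  have hPpos : 0 < P := by positivity
  have hd : 0 < C₀ - 1 := by linarith
  set s := (C₀ + 1) / 2 * ε with hs
  have hspos : 0 < s := by positivity
  have hsC : s < C₀ * ε := by rw [hs]; gcongr; linarith
  have hεs : ε < s := by rw [hs]; nlinarith
  have hball : ∀ (c : ℂ) (r : ℝ) (w : ℂ), w ∈ ball c r → ‖c‖ - r < ‖w‖ ∧ ‖w‖ < ‖c‖ + r := by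
    intro c r w hw
    have h3 : ‖w - c‖ < r := by simpa [dist_eq_norm] using hw
    have h4 := norm_sub_norm_le w c
    have h5 := norm_sub_norm_le c w
    rw [norm_sub_rev] at h5
    constructor <;> linarith
  have hA : ∀ w, ‖w‖ = R / 2 → ‖complexGrad f w‖ ≤ 32 * N / R := by
    intro w hw
    have hsub : ∀ v ∈ ball w (R / 4), ε < ‖v‖ ∧ ‖v‖ < R := fun v hv => by
      have := hball _ _ _ hv
      rw [hw] at this
      constructor <;> linarith
    refine (norm_complexGrad_le (r := R / 4) (by linarith) hN (hf.mono hsub) fun v hv =>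
      h2 v (hsub v hv).1 (hsub v hv).2.le).trans (le_of_eq ?_)
    field_simp; ring
  have hB : ∀ w, ‖w‖ = s → ‖complexGrad f w‖ ≤ 16 * P / ((C₀ - 1) * ε) := by
    intro w hw
    have hsub : ∀ v ∈ ball w ((C₀ - 1) / 2 * ε), ε < ‖v‖ ∧ ‖v‖ < C₀ * ε := fun v hv => by
      have := hball _ _ _ hv
      rw [hw, hs] at this
      constructor <;> linarith
    refine (norm_complexGrad_le (r := (C₀ - 1) / 2 * ε) (by positivity) hPpos
      (hf.mono fun v hv => ⟨(hsub v hv).1, by linarith [(hsub v hv).2]⟩) fun v hv => ?_).trans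
        (le_of_eq ?_)
    · have h3 := hsub v hv
      refine (abs_le_log_barrier hε (by linarith) hκ.le hf hc h1
        (fun w hw => h2 w (by linarith) hw.le) v h3.1 (by linarith)).trans ?_
      rw [hP, div_mul_eq_mul_div]
      gcongr
      · exact div_pos (by linarith) hε
      · rw [div_le_iff₀ hε]; exact h3.2.le
    · field_simp; ring
  have hz0 : 0 < ‖z‖ := by nlinarith
  have key := norm_le_of_annulus (g := complexGrad f) (R := R / 2) hspos (fun w hw1 hw2 =>
    HarmonicAt.differentiableAt_complex_partial (hf w ⟨by linarith, by linarith⟩)) hA hB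
      (z := z) (by linarith) (by linarith)
  refine (mul_le_mul_of_nonneg_right key hz0.le).trans ?_
  rw [add_mul]
  refine add_le_add ?_ ?_
  · gcongr
    have : 32 * N / R / (R / 2 - ‖z‖) ≤ 32 * N / R / (R / 4) := by
      gcongr; linarith
    calc _ ≤ R / 2 * (32 * N / R / (R / 4)) := by gcongr
      _ = 64 * N / R := by field_simp; ring
  · have h3 : 0 < ‖z‖ - s := by linarith
    have h4 : ‖z‖ * (C₀ - 1) ≤ 2 * C₀ * (‖z‖ - s) := by rw [hs]; nlinarith
    have h5 : ‖z‖ / (‖z‖ - s) ≤ 2 * C₀ / (C₀ - 1) := by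
      rw [div_le_div_iff₀ h3 hd]; linarith
    calc s * (16 * P / ((C₀ - 1) * ε) / (‖z‖ - s)) * ‖z‖
        = 8 * (C₀ + 1) * P / (C₀ - 1) * (‖z‖ / (‖z‖ - s)) := by
          rw [hs]; field_simp; ring
      _ ≤ 8 * (C₀ + 1) * P / (C₀ - 1) * (2 * C₀ / (C₀ - 1)) := by gcongr
      _ = _ := by field_simp; ring

/-- The isometric identification of `ℂ` with the Euclidean plane. -/
def planeIso : ℂ ≃ₗᵢ[ℝ] E2 := Complex.orthonormalBasisOneI.repr

lemma planeIso_one : planeIso 1 = EuclideanSpace.single 0 1 := by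
  simpa [planeIso] using Complex.orthonormalBasisOneI.repr_self 0

lemma planeIso_I : planeIso Complex.I = EuclideanSpace.single 1 1 := by
  simpa [planeIso] using Complex.orthonormalBasisOneI.repr_self 1

/-- The homeomorphism from `ℂ` onto the plane sending `0` to `x₀`. -/
def planeChart (x₀ : E2) : ℂ ≃ₜ E2 := planeIso.toHomeomorph.trans (Homeomorph.addLeft x₀)

lemma planeChart_apply (x₀ : E2) (z : ℂ) : planeChart x₀ z = x₀ + planeIso z := rfl

lemma norm_planeChart_sub (x₀ : E2) (z : ℂ) : ‖planeChart x₀ z - x₀‖ = ‖z‖ := by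
  simp [planeChart_apply]

lemma hasFDerivAt_comp_planeChart {F : Type*} [NormedAddCommGroup F] [NormedSpace ℝ F]
    {x₀ : E2} {u : E2 → F} {z : ℂ} (hu : DifferentiableAt ℝ u (planeChart x₀ z)) :
    HasFDerivAt (fun w => u (planeChart x₀ w))
      ((fderiv ℝ u (planeChart x₀ z)).comp (planeIso : ℂ →L[ℝ] E2)) z :=
  hu.hasFDerivAt.comp z ((planeIso : ℂ →L[ℝ] E2).hasFDerivAt.const_add x₀)

lemma contDiffAt_comp_planeChart {x₀ : E2} {u : E2 → ℝ} {z : ℂ}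
    (hu : ContDiffAt ℝ 2 u (planeChart x₀ z)) :
    ContDiffAt ℝ 2 (fun w => u (planeChart x₀ w)) z :=
  hu.comp z (contDiffAt_const.add (planeIso : ℂ →L[ℝ] E2).contDiff.contDiffAt)

open InnerProductSpace Laplacian in
lemma laplacian_comp_planeChart {x₀ : E2} {u : E2 → ℝ} {z : ℂ}
    (hu : ContDiffAt ℝ 2 u (planeChart x₀ z)) :
    Δ (fun w => u (planeChart x₀ w)) z = lap u (planeChart x₀ z) := by
  have hev : fderiv ℝ (fun w => u (planeChart x₀ w)) =ᶠ[𝓝 z] fun w =>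
      (ContinuousLinearMap.compL ℝ ℂ E2 ℝ).flip (planeIso : ℂ →L[ℝ] E2)
        (fderiv ℝ u (planeChart x₀ w)) := by
    have h := (planeChart x₀).continuous.continuousAt.eventually (hu.eventually (by simp))
    filter_upwards [h] with w hw
    exact (hasFDerivAt_comp_planeChart (hw.differentiableAt (by simp))).fderiv
  have hd : DifferentiableAt ℝ (fderiv ℝ u) (planeChart x₀ z) :=
    (hu.fderiv_right (m := 1) (by norm_num)).differentiableAt (by simp)
  have hpd : ∀ i j, pd2 u (planeChart x₀ z) i j = fderiv ℝ (fderiv ℝ u) (planeChart x₀ z)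
      (EuclideanSpace.single i 1) (EuclideanSpace.single j 1) := by
    intro i j
    rw [pd2, fderiv_clm_apply hd (by fun_prop)]
    simp
  have hF := (((ContinuousLinearMap.compL ℝ ℂ E2 ℝ).flip
    (planeIso : ℂ →L[ℝ] E2)).hasFDerivAt.comp z (hasFDerivAt_comp_planeChart hd)).congr_of_eventuallyEq hev
  simp only [laplacian_eq_iteratedFDeriv_complexPlane, iteratedFDeriv_two_apply, hF.fderiv]
  simp [lap, hpd, planeIso_one, planeIso_I]

lemma harmonicAt_sub_comp_planeChart {x₀ : E2} {U : Set E2} (hU : IsOpen U) {u v : E2 → ℝ} {k : ℝ}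
    (hu : ∀ x ∈ U, ContDiffAt ℝ 2 u x ∧ lap u x = k)
    (hv : ∀ x ∈ U, ContDiffAt ℝ 2 v x ∧ lap v x = k) {z : ℂ} (hz : planeChart x₀ z ∈ U) :
    InnerProductSpace.HarmonicAt
      ((fun w => u (planeChart x₀ w)) - fun w => v (planeChart x₀ w)) z := by
  refine ⟨(contDiffAt_comp_planeChart (hu _ hz).1).sub (contDiffAt_comp_planeChart (hv _ hz).1), ?_⟩
  filter_upwards [(hU.preimage (planeChart x₀).continuous).mem_nhds hz] with w hw
  rw [(contDiffAt_comp_planeChart (hu _ hw).1).laplacian_sub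
    (contDiffAt_comp_planeChart (hv _ hw).1), laplacian_comp_planeChart (hu _ hw).1,
    laplacian_comp_planeChart (hv _ hw).1, (hu _ hw).2, (hv _ hw).2]
  simp

lemma hasFDerivAt_log_norm {z : ℂ} (hz : z ≠ 0) :
    HasFDerivAt (fun w : ℂ => Real.log ‖w‖) ((1 / ‖z‖ ^ 2) • innerSL ℝ z) z := by
  have h := ((hasStrictFDerivAt_norm_sq z).hasFDerivAt.log
    (pow_ne_zero 2 (norm_ne_zero_iff.2 hz))).const_mul (1 / 2)
  have h2 : (fun w : ℂ => 1 / 2 * Real.log (‖w‖ ^ 2)) = fun w => Real.log ‖w‖ := by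
    ext w; rw [Real.log_pow]; push_cast; ring
  rw [h2] at h
  refine h.congr_fderiv ?_
  ext; simp; ring

/-- The gradient remainder in the plane is controlled by the derivative in the complex chart. -/
lemma norm_gradient_sub_sub_le {x₀ : E2} {u v : E2 → ℝ} {z : ℂ} (hz : z ≠ 0) (c : ℝ)
    (hu : DifferentiableAt ℝ u (planeChart x₀ z)) (hv : DifferentiableAt ℝ v (planeChart x₀ z)) :
    ‖gradient u (planeChart x₀ z) - gradient v (planeChart x₀ z) -
      (c / ‖z‖ ^ 2) • (planeChart x₀ z - x₀)‖ ≤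
    ‖fderiv ℝ (((fun w => u (planeChart x₀ w)) - fun w => v (planeChart x₀ w)) -
      c • fun w => Real.log ‖w‖) z‖ := by
  rw [(((hasFDerivAt_comp_planeChart hu).sub (hasFDerivAt_comp_planeChart hv)).sub
    ((hasFDerivAt_log_norm hz).const_smul c)).fderiv,
    ← (InnerProductSpace.toDual ℝ E2).norm_map]
  refine ContinuousLinearMap.opNorm_le_bound _ (norm_nonneg _) fun y => ?_
  obtain ⟨w, rfl⟩ := planeIso.surjective y
  rw [planeIso.norm_map]
  refine le_trans (le_of_eq ?_) (ContinuousLinearMap.le_opNorm _ w)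
  congr 1
  have h1 : inner ℝ (planeIso z) (planeIso w) = inner ℝ z w := planeIso.inner_map_map z w
  simp only [map_sub, map_smul, gradient, LinearIsometryEquiv.apply_symm_apply, planeChart_apply,
    add_sub_cancel_left, sub_apply, smul_apply,
    InnerProductSpace.toDual_apply_apply, h1, ContinuousLinearMap.comp_apply, innerSL_apply_apply,
    smul_eq_mul]
  simp
  ring

lemma eventually_small_parameters {ε₁ r δ' C₀ K M Q : ℝ} (hε₁ : 0 < ε₁) (hr : 0 < r)
    (hδ : 0 < δ') :
    ∀ᶠ ε in 𝓝[>] (0 : ℝ), ε < 1 ∧ 4 * ε ≤ ε₁ ∧ ε < r ∧ K * ε * |Real.log ε| ≤ 1 ∧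
      Q * (K * ε * |Real.log ε| + M * Real.log C₀ / Real.log (ε₁ / ε)) ≤ δ' := by
  have hlt : ∀ {b : ℝ}, 0 < b → ∀ᶠ ε in 𝓝[>] (0 : ℝ), ε < b := fun hb =>
    (eventually_lt_nhds hb).filter_mono nhdsWithin_le_nhds
  have h1 : Tendsto (fun ε : ℝ => K * ε * |Real.log ε|) (𝓝[>] 0) (𝓝 0) := by
    have h := ((tendsto_log_mul_rpow_nhdsGT_zero one_pos).abs).const_mul K
    rw [abs_zero, mul_zero] at h
    refine h.congr' ?_
    filter_upwards [self_mem_nhdsWithin] with ε hε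
    rw [Real.rpow_one, abs_mul, abs_of_pos (show (0 : ℝ) < ε from hε)]
    ring
  have h2 : Tendsto (fun ε : ℝ => Real.log (ε₁ / ε)) (𝓝[>] 0) atTop := by
    simp only [div_eq_mul_inv]
    exact Real.tendsto_log_atTop.comp (tendsto_inv_nhdsGT_zero.const_mul_atTop hε₁)
  have h3 := (h1.add (h2.const_div_atTop (M * Real.log C₀))).const_mul Q
  rw [add_zero, mul_zero] at h3
  filter_upwards [hlt one_pos, hlt (show 0 < ε₁ / 4 by positivity), hlt hr,
    h1.eventually_le_const one_pos, h3.eventually_le_const hδ] with ε a1 a2 a3 a4 a5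
  exact ⟨a1, by linarith, a3, a4, a5⟩

lemma inter_subset_closure_diff_closedBall {Ω : Set E2} (hΩ : IsOpen Ω) (x₀ : E2) {ε : ℝ}
    (hε : 0 < ε) {x : E2} (hx : x ∈ Ω) (hxε : ε ≤ ‖x - x₀‖) :
    x ∈ closure (Ω \ closedBall x₀ ε) := by
  have h : x ∈ closure (closedBall x₀ ε)ᶜ := by
    rw [closure_compl, interior_closedBall _ hε.ne']
    simpa [dist_eq_norm] using hxε
  exact hΩ.inter_closure ⟨hx, h⟩

lemma mem_frontier_diff_closedBall {Ω : Set E2} (hΩ : IsOpen Ω) {x₀ : E2} {ε : ℝ} {x : E2}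
    (hx : x ∈ frontier (Ω \ closedBall x₀ ε)) : ‖x - x₀‖ = ε ∨ x ∈ frontier Ω := by
  rw [frontier, (hΩ.sdiff isClosed_closedBall).interior_eq] at hx
  have h1 : x ∈ closure Ω := closure_mono Set.sdiff_subset hx.1
  have h2 : ε ≤ ‖x - x₀‖ := by
    have h : Ω \ closedBall x₀ ε ⊆ {y | ε ≤ ‖y - x₀‖} := fun y hy => by
      have := hy.2
      simp only [mem_closedBall, dist_eq_norm, not_le] at this
      exact this.le
    exact closure_minimal h (isClosed_le continuous_const (by fun_prop)) hx.1
  by_contra! hcon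
  rw [frontier, hΩ.interior_eq] at hcon
  have hxΩ : x ∈ Ω := by
    by_contra h
    exact hcon.2 ⟨h1, h⟩
  refine hx.2 ⟨hxΩ, ?_⟩
  simp only [mem_closedBall, dist_eq_norm, not_le]
  exact lt_of_le_of_ne h2 hcon.1.symm

lemma exists_abs_sub_le_mul_norm {u : E2 → ℝ} {x₀ : E2} (hu : DifferentiableAt ℝ u x₀) :
    ∃ K > 0, ∃ r > 0, ∀ x, ‖x - x₀‖ < r → |u x - u x₀| ≤ K * ‖x - x₀‖ := by
  obtain ⟨K, hK, hO⟩ := hu.isBigO_sub.exists_pos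
  obtain ⟨r, hr, h⟩ := Metric.eventually_nhds_iff.1 hO.bound
  exact ⟨K, hK, r, hr, fun x hx => h (by rwa [dist_eq_norm])⟩

lemma exists_abs_mul_log_le_on_frontier {Ω : Set E2} (hΩo : IsOpen Ω)
    (hΩb : Bornology.IsBounded Ω) {x₀ : E2} (hx₀ : x₀ ∈ Ω) (a : ℝ) :
    ∃ M > 0, ∀ x ∈ frontier Ω, |a * Real.log ‖x - x₀‖| ≤ M := by
  have hK : IsCompact (frontier Ω) :=
    hΩb.isCompact_closure.of_isClosed_subset isClosed_frontier frontier_subset_closure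
  have hc : ContinuousOn (fun x => a * Real.log ‖x - x₀‖) (frontier Ω) := by
    refine continuousOn_const.mul (ContinuousOn.log (by fun_prop) fun x hx => ?_)
    rw [norm_ne_zero_iff, sub_ne_zero]
    rintro rfl
    rw [frontier, hΩo.interior_eq] at hx
    exact hx.2 hx₀
  obtain ⟨M, hM⟩ := hK.exists_bound_of_continuousOn hc
  exact ⟨max M 1, by positivity, fun x hx => (hM x hx).trans (le_max_left _ _)⟩

/-- Gradient expansion near the hole: for `C₀ε ≤ |x-x₀| ≤ ρ`,
`∇u_ε(x) = ∇u₀(x) + u₀(x₀)(x-x₀)/(|log ε||x-x₀|²) + o(1/(|log ε||x-x₀|))`. -/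
theorem grad_uEps_expansion_near_hole
    (Ω : Set E2) (hΩo : IsOpen Ω) (hΩb : Bornology.IsBounded Ω) (hΩc : Convex ℝ Ω)
    (u₀ : E2 → ℝ) (h₀ : IsTorsion Ω u₀)
    (x₀ : E2) (hx₀ : x₀ ∈ Ω)
    (ε₁ : ℝ) (hε₁ : 0 < ε₁) (hball : closedBall x₀ ε₁ ⊆ Ω)
    (uε : ℝ → E2 → ℝ)
    (huε : ∀ ε ∈ Ioo (0:ℝ) ε₁, IsTorsion (Ω \ closedBall x₀ ε) (uε ε)) :
    ∀ C₀ > 1, ∀ δ > 0, ∃ ρ > 0, ∃ ε₀ > 0, ε₀ ≤ ε₁ ∧ ∀ ε ∈ Ioo (0:ℝ) ε₀,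
      ∀ x ∈ Ω \ closedBall x₀ ε, C₀ * ε ≤ ‖x - x₀‖ → ‖x - x₀‖ ≤ ρ →
        ‖gradient (uε ε) x - gradient u₀ x
            - (u₀ x₀ / (|Real.log ε| * ‖x - x₀‖ ^ 2)) • (x - x₀)‖
          ≤ δ / (|Real.log ε| * ‖x - x₀‖) := by
  intro C₀ hC₀ δ hδ
  obtain ⟨hc₀, hd₀, hl₀, hz₀⟩ := h₀
  obtain ⟨K, hK, r, hr, hKr⟩ :=
    exists_abs_sub_le_mul_norm ((hd₀ x₀ hx₀).differentiableAt (by simp))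
  set a := u₀ x₀ with ha
  obtain ⟨M, hM0, hM⟩ := exists_abs_mul_log_le_on_frontier hΩo hΩb hx₀ a
  obtain ⟨ε₂, hε₂, hsmall⟩ := mem_nhdsGT_iff_exists_Ioo_subset.1
    (eventually_small_parameters (C₀ := C₀) (K := K) (M := M + 1)
      (Q := 16 * C₀ * (C₀ + 1) / (C₀ - 1) ^ 2) hε₁ hr (half_pos hδ))
  refine ⟨min (ε₁ / 4) (δ * ε₁ / (128 * (M + 1))), by positivity, min ε₂ ε₁,
    lt_min hε₂ hε₁, min_le_right _ _, ?_⟩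
  rintro ε ⟨hε, hεlt⟩ x hx hx1 hx2
  have hεε₁ : ε < ε₁ := hεlt.trans_le (min_le_right _ _)
  obtain ⟨hε1, h4ε, hεr, hKL, hQ⟩ := hsmall ⟨hε, hεlt.trans_le (min_le_left _ _)⟩
  obtain ⟨hcε, hdε, hlε, hzε⟩ := huε ε ⟨hε, hεε₁⟩
  set L := |Real.log ε| with hL
  have hlogneg : Real.log ε < 0 := Real.log_neg hε hε1
  have hlog : Real.log ε = -L := by rw [hL, abs_of_neg hlogneg, neg_neg]
  have hLpos : 0 < L := by linarith
  set U := Ω \ closedBall x₀ ε with hU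
  have hUo : IsOpen U := hΩo.sdiff isClosed_closedBall
  set φ := planeChart x₀ with hφ
  have hφn : ∀ z, ‖φ z - x₀‖ = ‖z‖ := norm_planeChart_sub x₀
  have hφΩ : ∀ z, ‖z‖ ≤ ε₁ → φ z ∈ Ω := fun z hz =>
    hball (by rwa [mem_closedBall, dist_eq_norm, hφn])
  have hφU : ∀ z, φ z ∈ U ↔ φ z ∈ Ω ∧ ε < ‖z‖ := fun z => by
    rw [hU, Set.mem_sdiff, mem_closedBall, dist_eq_norm, hφn, not_le]
  set V := φ ⁻¹' U with hV
  have hVcl : closure V = φ ⁻¹' closure U := (φ.preimage_closure U).symm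
  have hVfr : frontier V = φ ⁻¹' frontier U := (φ.preimage_frontier U).symm
  have hannV : ∀ z : ℂ, ε < ‖z‖ → ‖z‖ ≤ ε₁ → z ∈ V := fun z h1 h2 => (hφU z).2 ⟨hφΩ z h2, h1⟩
  have hann : ∀ z : ℂ, ε ≤ ‖z‖ → ‖z‖ ≤ ε₁ → z ∈ closure V := fun z h1 h2 => by
    rw [hVcl]
    exact inter_subset_closure_diff_closedBall hΩo x₀ hε (hφΩ z h2) (by rwa [hφn])
  have hclnorm : ∀ z ∈ closure V, ε ≤ ‖z‖ := fun z hz =>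
    closure_minimal (fun w hw => ((hφU w).1 hw).2.le) (isClosed_le continuous_const continuous_norm)
      hz
  have hVo : IsOpen V := hUo.preimage φ.continuous
  have hVb : Bornology.IsBounded V := by
    obtain ⟨B, hB⟩ := hΩb.subset_closedBall x₀
    refine (Metric.isBounded_closedBall (x := (0 : ℂ)) (r := B)).subset fun z hz => ?_
    have := hB ((hφU z).1 hz).1
    rw [mem_closedBall, dist_eq_norm, hφn] at this
    simpa using this
  set f : ℂ → ℝ := ((fun w => uε ε (φ w)) - fun w => u₀ (φ w)) -
    (a / L) • fun w => Real.log ‖w‖ with hf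
  have hfapp : ∀ z, f z = uε ε (φ z) - u₀ (φ z) - a / L * Real.log ‖z‖ := fun z => by simp [hf]
  have hfh : InnerProductSpace.HarmonicOnNhd f V := fun z hz =>
    (harmonicAt_sub_comp_planeChart hUo (fun y hy => ⟨hdε y hy, hlε y hy⟩)
      (fun y hy => ⟨hd₀ y hy.1, hl₀ y hy.1⟩) hz).sub
      (harmonicAt_log_norm (norm_pos_iff.1 (hε.trans ((hφU z).1 hz).2))).const_smul
  have hfc : ContinuousOn f (closure V) := by
    refine ((hcε.comp φ.continuous.continuousOn fun z hz => ?_).sub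
      (hc₀.comp φ.continuous.continuousOn fun z hz => ?_)).sub
      (ContinuousOn.const_smul (continuous_norm.continuousOn.log fun z hz =>
        (hε.trans_le (hclnorm z hz)).ne') _)
    · rwa [hVcl] at hz
    · rw [hVcl] at hz
      exact closure_mono Set.sdiff_subset hz
  have hinner : ∀ z : ℂ, ‖z‖ = ε → |f z| ≤ K * ε := fun z hz => by
    have hzfr : φ z ∈ frontier U := by
      rw [frontier, hUo.interior_eq]
      refine ⟨?_, fun h => ((hφU z).1 h).2.ne' hz⟩
      have := hann z hz.ge (by linarith)
      rwa [hVcl] at this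
    have h1 := hKr (φ z) (by rwa [hφn, hz])
    rw [hφn, hz] at h1
    rw [hfapp, hzε _ hzfr, hz, hlog, mul_neg, div_mul_cancel₀ _ hLpos.ne', zero_sub, sub_neg_eq_add,
      neg_add_eq_sub, abs_sub_comm]
    exact h1
  have hKN : K * ε ≤ (M + 1) / L := by
    rw [le_div_iff₀ hLpos]
    linarith
  have hfr : ∀ z ∈ frontier V, |f z| ≤ (M + 1) / L := fun z hz => by
    have hz' : φ z ∈ frontier U := by rwa [hVfr] at hz
    rcases mem_frontier_diff_closedBall hΩo hz' with h | h
    · exact (hinner z (by rwa [hφn] at h)).trans hKN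
    · have h1 := hM _ h
      rw [hφn] at h1
      rw [hfapp, hzε _ hz', hz₀ _ h, sub_zero, zero_sub, abs_neg, div_mul_eq_mul_div, abs_div,
        abs_of_pos hLpos]
      gcongr
      linarith
  have hfN : ∀ z ∈ V, |f z| ≤ (M + 1) / L := abs_le_of_frontier_abs_le hVo hVb hfh hfc hfr
  obtain ⟨z, rfl⟩ := φ.surjective x
  rw [hφn] at hx1 hx2 ⊢
  have hz0 : 0 < ‖z‖ := hε.trans ((hφU z).1 hx).2
  have key := norm_complexGrad_mul_norm_le (z := z) hC₀ hε h4ε (mul_pos hK hε)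
    (div_pos (by linarith) hLpos) (hfh.mono fun w hw => hannV w hw.1 hw.2.le)
    (hfc.mono fun w hw => hann w hw.1 hw.2) hinner (fun w h1 h2 => hfN w (hannV w h1 h2)) hx1
    (hx2.trans (min_le_left _ _))
  have hgrad := norm_gradient_sub_sub_le (norm_pos_iff.1 hz0) (a / L)
    ((hdε _ hx).differentiableAt (by simp)) ((hd₀ _ hx.1).differentiableAt (by simp))
  rw [div_div] at hgrad
  refine hgrad.trans ((norm_fderiv_le_norm_complexGrad f z).trans ?_)
  rw [le_div_iff₀ (by positivity)]
  have h1 : 64 * (M + 1) / ε₁ * ‖z‖ ≤ δ / 2 := by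
    have h := hx2.trans (min_le_right _ _)
    rw [le_div_iff₀ (by positivity)] at h
    rw [div_mul_eq_mul_div, div_le_iff₀ hε₁]
    linarith
  calc ‖complexGrad f z‖ * (L * ‖z‖) = ‖complexGrad f z‖ * ‖z‖ * L := by ring
    _ ≤ _ := mul_le_mul_of_nonneg_right key hLpos.le
    _ = 64 * (M + 1) / ε₁ * ‖z‖ + 16 * C₀ * (C₀ + 1) / (C₀ - 1) ^ 2 *
        (K * ε * L + (M + 1) * Real.log C₀ / Real.log (ε₁ / ε)) := by
      field_simp
    _ ≤ δ := by linarith
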